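/- arXiv:math/0309372 — 2 statements merged into one kernel-verified Lean document; each statement's English description precedes it below -/
import Mathlib

section
/- Let α, β, γ, μ be complex numbers and ε a real number with Re γ > Re α > 0, Re β > 0, 0 < ε < min(Re α, Re β), Re μ < 0 and 0 < Im μ < 2π. Then the Barnes integral B(α,β,γ;μ,ε) converges absolutely and B(α,β,γ;μ,ε) = (Γ(α)Γ(β)/Γ(γ)) · Σ_{n=0}^{∞} [(α)_n (β)_n / ((γ)_n · n!)] e^{nμ}, where the series on the right converges absolutely (it is the Gauss hypergeometric series ₂F₁(α,β;γ;e^μ), and |e^μ| < 1). -/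
open Complex MeasureTheory Real

/-- The Barnes integral `B(α,β,γ;μ,ε)`:
`(1/(2π)) ∫_{−∞}^{∞} e^{(−ε+iy)(μ−πi)} Γ(ε−iy) Γ(α−ε+iy) Γ(β−ε+iy) / Γ(γ−ε+iy) dy`. -/
noncomputable def BarnesB (α β γ μ : ℂ) (ε : ℝ) : ℂ :=
  (1 / (2 * (π : ℂ))) * ∫ y : ℝ,
    Complex.exp ((-(ε : ℂ) + Complex.I * (y : ℂ)) * (μ - (π : ℂ) * Complex.I)) *
      Complex.Gamma ((ε : ℂ) - Complex.I * (y : ℂ)) *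
      Complex.Gamma (α - (ε : ℂ) + Complex.I * (y : ℂ)) *
      Complex.Gamma (β - (ε : ℂ) + Complex.I * (y : ℂ)) /
      Complex.Gamma (γ - (ε : ℂ) + Complex.I * (y : ℂ))

open Set Filter Topology

/-- The integrand `t ^ (a - 1) * e ^ (-r t)` of the rotated Gamma integral is integrable. -/
lemma integrableOn_cpow_mul_cexp_neg_mul {a r : ℂ} (ha : 0 < a.re) (hr : 0 < r.re) :
    IntegrableOn (fun t : ℝ => (t : ℂ) ^ (a - 1) * Complex.exp (-(r * t))) (Ioi 0) := by
  have h := integrableOn_rpow_mul_exp_neg_mul_rpow (p := 1) (s := a.re - 1) (by linarith)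
    one_pos hr
  refine Integrable.mono' h ?_ ?_
  · refine ContinuousOn.aestronglyMeasurable (fun t ht => ?_) measurableSet_Ioi
    exact ((continuousAt_ofReal_cpow_const _ _ (Or.inr (ne_of_gt ht))).mul
      (by fun_prop)).continuousWithinAt
  · filter_upwards [ae_restrict_mem measurableSet_Ioi] with t ht
    rw [norm_mul, Complex.norm_cpow_eq_rpow_re_of_pos ht, Complex.norm_exp]
    simp

/-- The Gamma integral along a complex ray: Mathlib has the case of real `r`. -/
lemma integral_cpow_mul_cexp_neg_mul {a r : ℂ} (ha : 0 < a.re) (hr : 0 < r.re) :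
    ∫ t : ℝ in Ioi 0, (t : ℂ) ^ (a - 1) * Complex.exp (-(r * t)) =
      r ^ (-a) * Complex.Gamma a := by
  have hU : IsOpen {z : ℂ | 0 < z.re} := isOpen_lt continuous_const Complex.continuous_re
  have hL : DifferentiableOn ℂ
      (fun z : ℂ => ∫ t : ℝ in Ioi 0, (t : ℂ) ^ (a - 1) * Complex.exp (-(z * t)))
      {z : ℂ | 0 < z.re} := by
    intro z hz
    have hz' : 0 < z.re := hz
    have hs : {w : ℂ | z.re / 2 < w.re} ∈ 𝓝 z :=
      (isOpen_lt continuous_const Complex.continuous_re).mem_nhds (by simp; linarith)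
    have hb := integrableOn_rpow_mul_exp_neg_mul_rpow (p := 1) (s := a.re) (b := z.re / 2)
      (by linarith) one_pos (by linarith)
    have key := hasDerivAt_integral_of_dominated_loc_of_deriv_le
      (μ := volume.restrict (Ioi (0 : ℝ)))
      (F := fun (z : ℂ) (t : ℝ) => (t : ℂ) ^ (a - 1) * Complex.exp (-(z * t)))
      (F' := fun (z : ℂ) (t : ℝ) => (t : ℂ) ^ (a - 1) * (Complex.exp (-(z * t)) * -(1 * t)))
      (bound := fun t : ℝ => t ^ a.re * Real.exp (-(z.re / 2) * t ^ (1 : ℝ)))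
      hs ?_ (integrableOn_cpow_mul_cexp_neg_mul ha hz') ?_ ?_ hb ?_
    · exact key.2.differentiableAt.differentiableWithinAt
    · filter_upwards [hU.mem_nhds hz] with w hw
      exact (integrableOn_cpow_mul_cexp_neg_mul ha hw).1
    · refine ContinuousOn.aestronglyMeasurable (fun t ht => ?_) measurableSet_Ioi
      exact ((continuousAt_ofReal_cpow_const _ _ (Or.inr (ne_of_gt ht))).mul
        (by fun_prop)).continuousWithinAt
    · filter_upwards [ae_restrict_mem measurableSet_Ioi] with t ht w hw
      have ht' : 0 < t := ht
      have hw' : z.re / 2 < w.re := hw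
      rw [norm_mul, norm_mul, Complex.norm_cpow_eq_rpow_re_of_pos ht, Complex.norm_exp]
      simp only [Complex.sub_re, Complex.one_re, Complex.neg_re, Complex.re_mul_ofReal, one_mul,
        norm_neg, Complex.norm_real, Real.norm_eq_abs, abs_of_pos ht', Real.rpow_one]
      rw [Real.rpow_sub_one ht'.ne', ← mul_assoc, div_mul_eq_mul_div, div_mul_eq_mul_div,
        mul_div_assoc, div_self ht'.ne', mul_one]
      gcongr
      nlinarith
    · refine Eventually.of_forall fun t w _ => ?_
      exact (((hasDerivAt_id w).mul_const (t : ℂ)).neg.cexp).const_mul _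
  have hR : DifferentiableOn ℂ (fun z : ℂ => z ^ (-a) * Complex.Gamma a) {z : ℂ | 0 < z.re} :=
    fun z hz => ((differentiableAt_id.cpow_const (Or.inl hz)).mul_const
      _).differentiableWithinAt
  have hconv : IsPreconnected {z : ℂ | 0 < z.re} :=
    (convex_halfSpace_re_gt 0).isPreconnected
  refine (hL.analyticOnNhd hU).eqOn_of_preconnected_of_frequently_eq (hR.analyticOnNhd hU) hconv
    (z₀ := 1) (by simp) ?_ hr
  have hreal : ∀ x : ℝ, 0 < x →
      ∫ t : ℝ in Ioi 0, (t : ℂ) ^ (a - 1) * Complex.exp (-((x : ℂ) * t)) =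
        (x : ℂ) ^ (-a) * Complex.Gamma a := by
    intro x hx
    rw [Complex.integral_cpow_mul_exp_neg_mul_Ioi ha hx, one_div, Complex.inv_cpow _ _
      (by rw [Complex.arg_ofReal_of_nonneg hx.le]; exact Real.pi_pos.ne), Complex.cpow_neg]
  have htend : Tendsto (fun x : ℝ => (x : ℂ)) (𝓝[≠] 1) (𝓝[≠] 1) := by
    refine tendsto_nhdsWithin_of_tendsto_nhds_of_eventually_within _ ?_ ?_
    · exact (Complex.continuous_ofReal.tendsto' 1 1 (by simp)).mono_left nhdsWithin_le_nhds
    · filter_upwards [self_mem_nhdsWithin] with x hx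
      simpa using hx
  refine htend.frequently (Eventually.frequently ?_)
  filter_upwards [nhdsWithin_le_nhds (Ioi_mem_nhds (zero_lt_one' ℝ))] with x hx
  exact hreal x hx

/-- Exponential decay of the Gamma function along vertical lines, at any rate below `π / 2`. -/
lemma exists_norm_Gamma_add_mul_I_le {a : ℂ} (ha : 0 < a.re) {θ : ℝ} (hθ0 : 0 ≤ θ)
    (hθ : θ < π / 2) :
    ∃ C, ∀ y : ℝ, ‖Complex.Gamma (a + Complex.I * y)‖ ≤ C * Real.exp (-θ * |y|) := by
  set K : ℝ := ∫ t : ℝ in Ioi 0, t ^ (a.re - 1) * Real.exp (-Real.cos θ * t) with hK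
  have key : ∀ φ : ℝ, |φ| = θ → ∀ y : ℝ,
      ‖Complex.Gamma (a + Complex.I * y)‖ ≤ K * Real.exp (-φ * (a.im + y)) := by
    intro φ hφ y
    have hcos : Real.cos φ = Real.cos θ := by rw [← hφ, Real.cos_abs]
    have hφ' := abs_lt.1 (hφ.trans_lt hθ)
    have hs : 0 < (a + Complex.I * y).re := by simpa using ha
    have hexp : Complex.exp (φ * Complex.I) ^ (-(a + Complex.I * y)) =
        Complex.exp (φ * Complex.I * (-(a + Complex.I * y))) := by
      rw [Complex.cpow_def_of_ne_zero (Complex.exp_ne_zero _), Complex.log_exp]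
      · simp; linarith [Real.pi_pos]
      · simp; linarith [Real.pi_pos]
    have h := integral_cpow_mul_cexp_neg_mul (r := Complex.exp (φ * Complex.I)) hs
      (by rw [Complex.exp_ofReal_mul_I_re]; exact Real.cos_pos_of_mem_Ioo hφ')
    have hn := norm_integral_le_integral_norm (μ := volume.restrict (Ioi (0 : ℝ)))
      (fun t : ℝ => (t : ℂ) ^ (a + Complex.I * y - 1) *
        Complex.exp (-(Complex.exp (φ * Complex.I) * t)))
    have hKeq : ∫ t : ℝ in Ioi 0, ‖(t : ℂ) ^ (a + Complex.I * y - 1) *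
        Complex.exp (-(Complex.exp (φ * Complex.I) * t))‖ = K := by
      refine setIntegral_congr_fun measurableSet_Ioi fun t ht => ?_
      rw [norm_mul, Complex.norm_cpow_eq_rpow_re_of_pos ht, Complex.norm_exp, ← hcos]
      simp [Complex.exp_ofReal_mul_I_re]
    rw [h, hKeq, hexp, norm_mul, Complex.norm_exp] at hn
    have he : (φ * Complex.I * (-(a + Complex.I * y))).re = φ * (a.im + y) := by simp; ring
    rw [he] at hn
    rw [neg_mul, Real.exp_neg, ← div_eq_mul_inv, le_div_iff₀ (Real.exp_pos _), mul_comm]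
    exact hn
  have hK0 : 0 ≤ K := setIntegral_nonneg measurableSet_Ioi fun t ht =>
    mul_nonneg (Real.rpow_nonneg (le_of_lt ht) _) (Real.exp_pos _).le
  refine ⟨K * Real.exp (θ * |a.im|), fun y => ?_⟩
  obtain ⟨φ, hφ, hφy⟩ : ∃ φ : ℝ, |φ| = θ ∧ φ * y = θ * |y| := by
    rcases le_total 0 y with hy | hy
    · exact ⟨θ, abs_of_nonneg hθ0, by rw [abs_of_nonneg hy]⟩
    · exact ⟨-θ, by rw [abs_neg, abs_of_nonneg hθ0], by rw [abs_of_nonpos hy]; ring⟩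
  refine (key φ hφ y).trans ?_
  rw [mul_assoc, ← Real.exp_add]
  gcongr
  have : -(φ * a.im) ≤ θ * |a.im| := by
    rw [← hφ, ← abs_mul]; exact neg_le_abs _
  linarith

lemma continuous_Gamma_add_mul_I {a : ℂ} (ha : 0 < a.re) :
    Continuous fun y : ℝ => Complex.Gamma (a + Complex.I * y) := by
  refine continuous_iff_continuousAt.2 fun y => ?_
  have h : DifferentiableAt ℂ Complex.Gamma (a + Complex.I * y) := by
    refine Complex.differentiableAt_Gamma _ fun m hm => ?_
    have := congrArg Complex.re hm
    simp at this
    have hm0 : (0 : ℝ) ≤ m := m.cast_nonneg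
    linarith
  exact ContinuousAt.comp (f := fun y : ℝ => a + Complex.I * (y : ℂ)) h.continuousAt
    (by fun_prop)

lemma continuous_Gamma_sub_mul_I {a : ℂ} (ha : 0 < a.re) :
    Continuous fun y : ℝ => Complex.Gamma (a - Complex.I * y) := by
  simpa [sub_eq_add_neg, Function.comp_def] using
    (continuous_Gamma_add_mul_I ha).comp continuous_neg

lemma integrable_exp_neg_mul_abs {c : ℝ} (hc : 0 < c) :
    Integrable fun y : ℝ => Real.exp (-c * |y|) := by
  rw [← integrableOn_univ, ← Iic_union_Ioi (a := (0 : ℝ))]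
  refine IntegrableOn.union ?_ ?_
  · refine (integrableOn_exp_mul_Iic hc 0).congr_fun (fun y hy => ?_) measurableSet_Iic
    simp [abs_of_nonpos (show y ≤ 0 from hy)]
  · refine (integrableOn_exp_mul_Ioi (neg_lt_zero.2 hc) 0).congr_fun (fun y hy => ?_)
      measurableSet_Ioi
    simp [abs_of_pos (show 0 < y from hy)]

lemma norm_cexp_add_mul_I_mul (ε y : ℝ) (v : ℂ) :
    ‖Complex.exp ((-(ε : ℂ) + Complex.I * y) * v)‖ =
      Real.exp (-ε * v.re) * Real.exp (-(y * v.im)) := by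
  rw [Complex.norm_exp, ← Real.exp_add]
  simp [sub_eq_add_neg]

/-- A continuous function on the line that decays faster than `exp (-|Im v| |y|)` is integrable
against `exp ((-ε + i y) v)`. -/
lemma integrable_mul_cexp {f : ℝ → ℂ} (hf : Continuous f) (ε : ℝ) {v : ℂ} {C θ : ℝ}
    (hfb : ∀ y, ‖f y‖ ≤ C * Real.exp (-θ * |y|)) (hv : |v.im| < θ) :
    Integrable fun y : ℝ => f y * Complex.exp ((-(ε : ℂ) + Complex.I * y) * v) := by
  refine Integrable.mono' (((integrable_exp_neg_mul_abs (sub_pos.2 hv)).const_mul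
    (C * Real.exp (-ε * v.re)))) (by fun_prop) (Eventually.of_forall fun y => ?_)
  rw [norm_mul, norm_cexp_add_mul_I_mul]
  have hC : 0 ≤ C * Real.exp (-θ * |y|) := (norm_nonneg _).trans (hfb y)
  have h1 : -(y * v.im) ≤ |v.im| * |y| := by
    rw [mul_comm, ← abs_mul, mul_comm]; exact neg_le_abs _
  calc ‖f y‖ * (Real.exp (-ε * v.re) * Real.exp (-(y * v.im)))
      ≤ (C * Real.exp (-θ * |y|)) * (Real.exp (-ε * v.re) * Real.exp (|v.im| * |y|)) := by
        gcongr; exact hfb y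
    _ = C * Real.exp (-ε * v.re) * (Real.exp (-θ * |y|) * Real.exp (|v.im| * |y|)) := by ring
    _ = _ := by rw [← Real.exp_add]; ring_nf

lemma exists_norm_Gamma_sub_mul_I_le {a : ℂ} (ha : 0 < a.re) {θ : ℝ} (hθ0 : 0 ≤ θ)
    (hθ : θ < π / 2) :
    ∃ C, ∀ y : ℝ, ‖Complex.Gamma (a - Complex.I * y)‖ ≤ C * Real.exp (-θ * |y|) := by
  obtain ⟨C, hC⟩ := exists_norm_Gamma_add_mul_I_le ha hθ0 hθ
  exact ⟨C, fun y => by simpa [sub_eq_add_neg] using hC (-y)⟩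

lemma integrable_Gamma_mul_cexp {a : ℂ} (ha : 0 < a.re) (ε : ℝ) {v : ℂ} (hv : |v.im| < π / 2) :
    Integrable fun y : ℝ => Complex.Gamma (a - Complex.I * y) *
      Complex.exp ((-(ε : ℂ) + Complex.I * y) * v) := by
  obtain ⟨θ, hθ1, hθ2⟩ := exists_between hv
  obtain ⟨C, hC⟩ := exists_norm_Gamma_sub_mul_I_le ha ((abs_nonneg _).trans hθ1.le) hθ2
  exact integrable_mul_cexp (continuous_Gamma_sub_mul_I ha) ε hC hθ1

lemma integrable_Gamma_mul_Gamma_mul_cexp {a b : ℂ} (ha : 0 < a.re) (hb : 0 < b.re) (ε : ℝ)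
    {v : ℂ} (hv : |v.im| < π) :
    Integrable fun y : ℝ => Complex.Gamma (a - Complex.I * y) *
      Complex.Gamma (b + Complex.I * y) * Complex.exp ((-(ε : ℂ) + Complex.I * y) * v) := by
  obtain ⟨θ, hθ1, hθ2⟩ := exists_between hv
  have hθ0 : 0 ≤ θ := (abs_nonneg _).trans hθ1.le
  obtain ⟨C, hC⟩ := exists_norm_Gamma_sub_mul_I_le ha (θ := θ / 2) (by linarith) (by linarith)
  obtain ⟨D, hD⟩ := exists_norm_Gamma_add_mul_I_le hb (θ := θ / 2) (by linarith) (by linarith)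
  refine integrable_mul_cexp (C := C * D)
    ((continuous_Gamma_sub_mul_I ha).mul (continuous_Gamma_add_mul_I hb)) ε (fun y => ?_) hθ1
  rw [Pi.mul_apply, norm_mul]
  calc _ ≤ (C * Real.exp (-(θ / 2) * |y|)) * (D * Real.exp (-(θ / 2) * |y|)) :=
        mul_le_mul (hC y) (hD y) (norm_nonneg _) ((norm_nonneg _).trans (hC y))
    _ = C * D * (Real.exp (-(θ / 2) * |y|) * Real.exp (-(θ / 2) * |y|)) := by ring
    _ = _ := by rw [← Real.exp_add]; ring_nf

/-- The Cahen–Mellin integral. -/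
lemma integral_Gamma_mul_cexp {ε : ℝ} (hε : 0 < ε) {v : ℂ} (hv : |v.im| < π / 2) :
    ∫ y : ℝ, Complex.Gamma ((ε : ℂ) - Complex.I * y) *
      Complex.exp ((-(ε : ℂ) + Complex.I * y) * v) = 2 * π * Complex.exp (-Complex.exp v) := by
  have hre : 0 < (Complex.exp v).re := by
    rw [Complex.exp_re]
    exact mul_pos (Real.exp_pos _) (Real.cos_pos_of_mem_Ioo (abs_lt.1 hv))
  have hlog : Complex.log (Complex.exp v) = v := by
    have := abs_lt.1 hv
    exact Complex.log_exp (by linarith [Real.pi_pos]) (by linarith [Real.pi_pos])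
  set f : ℝ → ℂ := fun t => Complex.exp (-(Complex.exp v * t)) with hf
  have hm : ∀ y : ℝ, mellin f (ε + y * Complex.I) =
      Complex.Gamma ((ε : ℂ) - Complex.I * (-y : ℝ)) *
      Complex.exp ((-(ε : ℂ) + Complex.I * (-y : ℝ)) * v) := by
    intro y
    have h := integral_cpow_mul_cexp_neg_mul (a := ε + y * Complex.I) (r := Complex.exp v)
      (by simpa using hε) hre
    rw [Complex.cpow_def_of_ne_zero (Complex.exp_ne_zero _), hlog] at h
    simp only [mellin, smul_eq_mul, hf, h]
    rw [mul_comm]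
    congr 2 <;> push_cast <;> ring
  have hint := integrable_Gamma_mul_cexp (a := (ε : ℂ)) (by simpa using hε) ε hv
  have hinv := mellinInv_mellin_eq ε f one_pos
    (integrableOn_cpow_mul_cexp_neg_mul (by simpa using hε) hre)
    (by
      rw [Complex.VerticalIntegrable]
      simp only [hm]
      exact hint.comp_neg)
    (by fun_prop)
  simp only [mellinInv, hm, Complex.ofReal_one, Complex.one_cpow, one_smul] at hinv
  rw [integral_neg_eq_self (fun y : ℝ => Complex.Gamma ((ε : ℂ) - Complex.I * y) *
      Complex.exp ((-(ε : ℂ) + Complex.I * y) * v))] at hinv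
  have hpi : (π : ℂ) ≠ 0 := by exact_mod_cast Real.pi_ne_zero
  have h2 : f 1 = Complex.exp (-Complex.exp v) := by simp [hf]
  rw [← h2, ← hinv, Complex.real_smul]
  generalize (∫ y : ℝ, Complex.Gamma ((ε : ℂ) - Complex.I * y) *
      Complex.exp ((-(ε : ℂ) + Complex.I * y) * v)) = J
  push_cast
  field_simp

/-- Fubini for a Mellin-type double integral. -/
lemma integral_mul_integral_cexp_log_swap {A B : ℝ → ℂ} {m : Measure ℝ} [SFinite m]
    (hA : Integrable A) (hB : Integrable B m) :
    ∫ y : ℝ, A y * ∫ t, B t * Complex.exp (Complex.I * y * (Real.log t : ℝ)) ∂m =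
      ∫ t, B t * (∫ y : ℝ, A y * Complex.exp (Complex.I * y * (Real.log t : ℝ))) ∂m := by
  have h : Integrable (Function.uncurry fun y t : ℝ =>
      Complex.exp (Complex.I * y * (Real.log t : ℝ)) * (A y * B t)) (volume.prod m) := by
    refine (hA.mul_prod hB).bdd_mul (c := 1) (Measurable.aestronglyMeasurable (by fun_prop))
      (Eventually.of_forall fun p => ?_)
    rw [Complex.norm_exp]
    simp
  have h' := integral_integral_swap h
  calc _ = ∫ y : ℝ, ∫ t, Complex.exp (Complex.I * y * (Real.log t : ℝ)) * (A y * B t) ∂m := by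
        refine integral_congr_ae (Eventually.of_forall fun y => ?_)
        beta_reduce
        rw [← integral_const_mul]
        congr 1 with t
        ring
    _ = _ := h'
    _ = _ := by
        refine integral_congr_ae (Eventually.of_forall fun t => ?_)
        beta_reduce
        rw [← integral_const_mul (B t)]
        congr 1 with y
        ring

lemma log_mul_of_re_pos {z w : ℂ} (hz : 0 < z.re) (hw : 0 < w.re) :
    Complex.log (z * w) = Complex.log z + Complex.log w := by
  have hz0 : z ≠ 0 := fun h => by simp [h] at hz
  have hw0 : w ≠ 0 := fun h => by simp [h] at hw
  have h1 := abs_lt.1 (Complex.abs_arg_lt_pi_div_two_iff.2 (Or.inl hz))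
  have h2 := abs_lt.1 (Complex.abs_arg_lt_pi_div_two_iff.2 (Or.inl hw))
  exact Complex.log_mul hz0 hw0 ⟨by linarith, by linarith⟩

/-- The Mellin–Barnes integral of the binomial function `(1 + e ^ v) ^ (-β)`. -/
lemma integral_Gamma_mul_Gamma_mul_cexp {ε : ℝ} {β v : ℂ} (hε : 0 < ε) (hεβ : ε < β.re)
    (hv : |v.im| < π) (hvre : v.re < 0) :
    ∫ y : ℝ, Complex.Gamma ((ε : ℂ) - Complex.I * y) *
      Complex.Gamma (β - ε + Complex.I * y) * Complex.exp ((-(ε : ℂ) + Complex.I * y) * v) =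
      2 * π * (Complex.Gamma β * (1 + Complex.exp v) ^ (-β)) := by
  set φ : ℝ := v.im / 2 with hφ
  have hφ' : φ ∈ Ioo (-(π / 2)) (π / 2) := by
    have := abs_lt.1 hv
    constructor <;> linarith
  set ρ : ℂ := Complex.exp (-(φ * Complex.I)) with hρ
  set u : ℂ := v - φ * Complex.I with hu
  have huim : u.im = φ := by simp [hu, hφ]; ring
  have hρre : 0 < ρ.re := by
    simpa [hρ, Complex.exp_re] using Real.cos_pos_of_mem_Ioo hφ'
  have hρlog : Complex.log ρ = -(φ * Complex.I) := by
    refine Complex.log_exp ?_ ?_ <;> simp <;> linarith [hφ'.1, hφ'.2, Real.pi_pos]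
  have hρ0 : ρ ≠ 0 := Complex.exp_ne_zero _
  have hρu : Complex.exp u = ρ * Complex.exp v := by
    rw [hρ, ← Complex.exp_add]; congr 1; rw [hu]; ring
  have hure : 0 < (Complex.exp u).re := by
    rw [Complex.exp_re, huim]
    exact mul_pos (Real.exp_pos _) (Real.cos_pos_of_mem_Ioo hφ')
  have hvpos : 0 < (1 + Complex.exp v).re := by
    have h1 : ‖Complex.exp v‖ < 1 := by
      rw [Complex.norm_exp]; simpa using hvre
    have h2 := (abs_lt.1 ((Complex.abs_re_le_norm _).trans_lt h1)).1
    rw [Complex.add_re, Complex.one_re]; linarith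
  have hβ : 0 < β.re := hε.trans hεβ
  have hβε : 0 < (β - ε).re := by simpa using hεβ
  have huabs : |u.im| < π / 2 := by rw [huim]; exact abs_lt.2 hφ'
  have hswap := integral_mul_integral_cexp_log_swap
    (integrable_Gamma_mul_cexp (a := (ε : ℂ)) (by simpa using hε) ε huabs)
    (integrableOn_cpow_mul_cexp_neg_mul hβε hρre)
  have hL : ∀ y : ℝ, ∫ t : ℝ in Ioi 0, (t : ℂ) ^ (β - ε - 1) * Complex.exp (-(ρ * t)) *
      Complex.exp (Complex.I * y * (Real.log t : ℝ)) =
      Complex.exp (φ * Complex.I * (β - ε + Complex.I * y)) *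
        Complex.Gamma (β - ε + Complex.I * y) := by
    intro y
    have h := integral_cpow_mul_cexp_neg_mul (a := β - ε + Complex.I * y) (r := ρ)
      (by simpa using hεβ) hρre
    rw [Complex.cpow_def_of_ne_zero hρ0, hρlog, neg_mul_neg] at h
    rw [← h]
    refine setIntegral_congr_fun measurableSet_Ioi fun t ht => ?_
    have ht0 : (t : ℂ) ≠ 0 := by exact_mod_cast (ne_of_gt ht)
    rw [show β - ε + Complex.I * y - 1 = (β - ε - 1) + Complex.I * y by ring,
      Complex.cpow_add _ _ ht0, Complex.cpow_def_of_ne_zero ht0 (Complex.I * y),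
      Complex.ofReal_log (le_of_lt ht), mul_comm (Complex.log t)]
    ring
  have hR : ∀ t ∈ Ioi (0 : ℝ), (t : ℂ) ^ (β - ε - 1) * Complex.exp (-(ρ * t)) *
      ∫ y : ℝ, Complex.Gamma ((ε : ℂ) - Complex.I * y) *
        Complex.exp ((-(ε : ℂ) + Complex.I * y) * u) *
        Complex.exp (Complex.I * y * (Real.log t : ℝ)) =
      2 * π * ((t : ℂ) ^ (β - 1) * Complex.exp (-(ρ * (1 + Complex.exp v) * t))) := by
    intro t ht
    have ht' : 0 < t := ht
    have ht0 : (t : ℂ) ≠ 0 := by exact_mod_cast ht'.ne'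
    have h := integral_Gamma_mul_cexp hε (v := u + (Real.log t : ℝ))
      (by simpa using huabs)
    have hexp : Complex.exp (u + (Real.log t : ℝ)) = ρ * Complex.exp v * t := by
      rw [Complex.exp_add, hρu, Complex.ofReal_log ht'.le, Complex.exp_log ht0]
    have hcongr : (fun y : ℝ => Complex.Gamma ((ε : ℂ) - Complex.I * y) *
        Complex.exp ((-(ε : ℂ) + Complex.I * y) * u) *
        Complex.exp (Complex.I * y * (Real.log t : ℝ))) = fun y : ℝ => (t : ℂ) ^ (ε : ℂ) *
        (Complex.Gamma ((ε : ℂ) - Complex.I * y) *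
        Complex.exp ((-(ε : ℂ) + Complex.I * y) * (u + (Real.log t : ℝ)))) := by
      ext y
      rw [Complex.cpow_def_of_ne_zero ht0, ← Complex.ofReal_log ht'.le, mul_assoc,
        ← Complex.exp_add, mul_left_comm, ← Complex.exp_add]
      congr 2; ring
    rw [hcongr, integral_const_mul, h, hexp,
      show β - 1 = (β - ε - 1) + ε by ring, Complex.cpow_add _ _ ht0,
      show -(ρ * (1 + Complex.exp v) * t) = -(ρ * t) + -(ρ * Complex.exp v * t) by ring,
      Complex.exp_add]
    ring
  rw [setIntegral_congr_fun measurableSet_Ioi hR, integral_const_mul,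
    integral_cpow_mul_cexp_neg_mul hβ (by rw [mul_add, mul_one, ← hρu, Complex.add_re]; linarith),
    Complex.cpow_def_of_ne_zero (mul_ne_zero hρ0 fun h => by simp [h] at hvpos),
    log_mul_of_re_pos hρre hvpos, hρlog, add_mul, Complex.exp_add] at hswap
  simp only [hL] at hswap
  rw [Complex.cpow_def_of_ne_zero (fun h => by simp [h] at hvpos)]
  have hcongr : (fun y : ℝ => Complex.Gamma ((ε : ℂ) - Complex.I * y) *
      Complex.exp ((-(ε : ℂ) + Complex.I * y) * u) *
      (Complex.exp (φ * Complex.I * (β - ε + Complex.I * y)) *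
        Complex.Gamma (β - ε + Complex.I * y))) = fun y : ℝ =>
      Complex.exp (-(φ * Complex.I) * -β) * (Complex.Gamma ((ε : ℂ) - Complex.I * y) *
      Complex.Gamma (β - ε + Complex.I * y) *
      Complex.exp ((-(ε : ℂ) + Complex.I * y) * v)) := by
    ext y
    have he : Complex.exp ((-(ε : ℂ) + Complex.I * y) * u) *
        Complex.exp (φ * Complex.I * (β - ε + Complex.I * y)) =
        Complex.exp (-(φ * Complex.I) * -β) *
          Complex.exp ((-(ε : ℂ) + Complex.I * y) * v) := by
      rw [← Complex.exp_add, ← Complex.exp_add, hu]; congr 1; ring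
    linear_combination (Complex.Gamma ((ε : ℂ) - Complex.I * y) *
      Complex.Gamma (β - ε + Complex.I * y)) * he
  rw [hcongr, integral_const_mul] at hswap
  refine mul_left_cancel₀ (Complex.exp_ne_zero (-(φ * Complex.I) * -β)) (hswap.trans ?_)
  ring

lemma hasSum_ascPochhammer_mul_pow (β : ℂ) {z : ℂ} (hz : ‖z‖ < 1) :
    HasSum (fun n : ℕ => (ascPochhammer ℂ n).eval β / (Nat.factorial n : ℂ) * z ^ n)
      ((1 - z) ^ (-β)) := by
  have h := (Complex.one_div_one_sub_cpow_hasFPowerSeriesOnBall_zero β).hasSum (y := z)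
    (by simpa [← ofReal_norm, ENNReal.ofReal_lt_one] using hz)
  rw [zero_add, one_div, ← Complex.cpow_neg] at h
  refine h.congr_fun fun n => ?_
  have hc := Ring.factorial_nsmul_multichoose_eq_ascPochhammer β n
  rw [Polynomial.ascPochhammer_smeval_eq_eval, Ring.multichoose_eq, nsmul_eq_mul] at hc
  have hn : (Nat.factorial n : ℂ) ≠ 0 := by exact_mod_cast n.factorial_ne_zero
  rw [← hc, mul_div_cancel_left₀ _ hn]
  simp [mul_comm]

lemma integrableOn_beta {u v : ℂ} (hu : 0 < u.re) (hv : 0 < v.re) :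
    IntegrableOn (fun t : ℝ => (t : ℂ) ^ (u - 1) * (1 - (t : ℂ)) ^ (v - 1)) (Ioc 0 1) :=
  (intervalIntegrable_iff_integrableOn_Ioc_of_le zero_le_one).1
    (Complex.betaIntegral_convergent hu hv)

lemma betaIntegral_eq_setIntegral (u v : ℂ) :
    Complex.betaIntegral u v =
      ∫ t : ℝ in Ioc 0 1, (t : ℂ) ^ (u - 1) * (1 - (t : ℂ)) ^ (v - 1) := by
  rw [Complex.betaIntegral, intervalIntegral.integral_of_le zero_le_one]

/-- Termwise integration of the binomial series in the Euler integral. -/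
lemma hasSum_mul_betaIntegral {α δ z : ℂ} (β : ℂ) (hα : 0 < α.re) (hδ : 0 < δ.re)
    (hz : ‖z‖ < 1) :
    HasSum (fun n : ℕ => (ascPochhammer ℂ n).eval β / (Nat.factorial n : ℂ) * z ^ n *
        Complex.betaIntegral (α + n) δ)
      (∫ t : ℝ in Ioc 0 1, (t : ℂ) ^ (α - 1) * (1 - (t : ℂ)) ^ (δ - 1) *
        (1 - z * t) ^ (-β)) := by
  set c : ℕ → ℂ := fun n => (ascPochhammer ℂ n).eval β / (Nat.factorial n : ℂ) * z ^ n with hc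
  set B : ℝ → ℂ := fun t => (t : ℂ) ^ (α - 1) * (1 - (t : ℂ)) ^ (δ - 1) with hB
  have hBint : IntegrableOn B (Ioc 0 1) := integrableOn_beta hα hδ
  have hpow : ∀ n : ℕ, ∀ t ∈ Ioc (0 : ℝ) 1, ‖(t : ℂ) ^ n‖ ≤ 1 := fun n t ht => by
    rw [norm_pow, Complex.norm_real, Real.norm_of_nonneg ht.1.le]
    exact pow_le_one₀ ht.1.le ht.2
  have hFint : ∀ n : ℕ, IntegrableOn (fun t : ℝ => c n * ((t : ℂ) ^ n * B t)) (Ioc 0 1) :=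
    fun n => (hBint.bdd_mul (c := 1) (Measurable.aestronglyMeasurable (by fun_prop))
      ((ae_restrict_mem measurableSet_Ioc).mono (hpow n))).const_mul _
  have hsum : Summable fun n : ℕ => ∫ t : ℝ in Ioc 0 1, ‖c n * ((t : ℂ) ^ n * B t)‖ := by
    refine Summable.of_nonneg_of_le (fun n => integral_nonneg fun t => norm_nonneg _)
      (fun n => ?_) ((hasSum_ascPochhammer_mul_pow β hz).summable.norm.mul_right
        (∫ t : ℝ in Ioc 0 1, ‖B t‖))
    rw [← integral_const_mul]
    refine setIntegral_mono_on (hFint n).norm (hBint.norm.const_mul _) measurableSet_Ioc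
      fun t ht => ?_
    rw [norm_mul (c n), norm_mul (_ ^ n)]
    exact mul_le_mul_of_nonneg_left (mul_le_of_le_one_left (norm_nonneg (B t)) (hpow n t ht))
      (norm_nonneg (c n))
  have h := hasSum_integral_of_summable_integral_norm hFint hsum
  have hval : ∫ t : ℝ in Ioc 0 1, ∑' n, c n * ((t : ℂ) ^ n * B t) =
      ∫ t : ℝ in Ioc 0 1, B t * (1 - z * t) ^ (-β) := by
    refine setIntegral_congr_fun measurableSet_Ioc fun t ht => ?_
    have hzt : ‖z * t‖ < 1 := by
      rw [norm_mul]
      exact (mul_le_of_le_one_right (norm_nonneg _) (by simpa using hpow 1 t ht)).trans_lt hz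
    rw [← ((hasSum_ascPochhammer_mul_pow β hzt).mul_left (B t)).tsum_eq]
    refine tsum_congr fun n => ?_
    rw [hc, mul_pow]
    ring
  rw [hval] at h
  refine h.congr_fun fun n => ?_
  rw [integral_const_mul, betaIntegral_eq_setIntegral]
  congr 1
  refine setIntegral_congr_fun measurableSet_Ioc fun t ht => ?_
  have ht0 : (t : ℂ) ≠ 0 := by exact_mod_cast ht.1.ne'
  rw [show α + n - 1 = n + (α - 1) by ring, Complex.cpow_add _ _ ht0, Complex.cpow_natCast,
    hB, mul_assoc]

lemma Gamma_add_natCast {z : ℂ} (hz : 0 < z.re) (n : ℕ) :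
    Complex.Gamma (z + n) = (ascPochhammer ℂ n).eval z * Complex.Gamma z := by
  rw [← Complex.Gamma_add_nat_div_Gamma_eq z fun k hk => ?_,
    div_mul_cancel₀ _ (Complex.Gamma_ne_zero_of_re_pos hz)]
  have := congrArg Complex.re hk
  simp at this
  linarith [(k.cast_nonneg : (0 : ℝ) ≤ k)]

/-- Euler's integral for the Gauss hypergeometric series. -/
lemma hasSum_hypergeometric {α γ z : ℂ} (β : ℂ) (hα : 0 < α.re) (hγα : α.re < γ.re)
    (hz : ‖z‖ < 1) :
    HasSum (fun n : ℕ => (ascPochhammer ℂ n).eval α * (ascPochhammer ℂ n).eval β /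
        ((ascPochhammer ℂ n).eval γ * (Nat.factorial n : ℂ)) * z ^ n)
      (Complex.Gamma γ / (Complex.Gamma α * Complex.Gamma (γ - α)) *
        ∫ t : ℝ in Ioc 0 1, (t : ℂ) ^ (α - 1) * (1 - (t : ℂ)) ^ (γ - α - 1) *
          (1 - z * t) ^ (-β)) := by
  have hδ : 0 < (γ - α).re := by simpa using hγα
  have hγ : 0 < γ.re := hα.trans hγα
  refine ((hasSum_mul_betaIntegral β hα hδ hz).mul_left
    (Complex.Gamma γ / (Complex.Gamma α * Complex.Gamma (γ - α)))).congr_fun fun n => ?_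
  have hαn : 0 < (α + n).re := by simpa using add_pos_of_pos_of_nonneg hα n.cast_nonneg
  have hγn : 0 < (γ + n).re := by simpa using add_pos_of_pos_of_nonneg hγ n.cast_nonneg
  have h0 := Complex.Gamma_ne_zero_of_re_pos hγn
  rw [Gamma_add_natCast hγ] at h0
  have hγ0 := right_ne_zero_of_mul h0
  have hp0 := left_ne_zero_of_mul h0
  have hα0 := Complex.Gamma_ne_zero_of_re_pos hα
  have hδ0 := Complex.Gamma_ne_zero_of_re_pos hδ
  have hn : (Nat.factorial n : ℂ) ≠ 0 := by exact_mod_cast n.factorial_ne_zero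
  rw [Complex.betaIntegral_eq_Gamma_mul_div _ _ hαn hδ,
    show α + n + (γ - α) = γ + n by ring, Gamma_add_natCast hα, Gamma_add_natCast hγ]
  field_simp

/-- The ratio of Gamma functions on a vertical line as a Beta integral. -/
lemma Gamma_div_Gamma_eq_integral {a c : ℂ} (ha : 0 < a.re) (hac : a.re < c.re) (y : ℝ) :
    Complex.Gamma (a + Complex.I * y) / Complex.Gamma (c + Complex.I * y) =
      (Complex.Gamma (c - a))⁻¹ * ∫ t : ℝ in Ioc 0 1,
        (t : ℂ) ^ (a - 1) * (1 - (t : ℂ)) ^ (c - a - 1) *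
          Complex.exp (Complex.I * y * (Real.log t : ℝ)) := by
  have hδ : 0 < (c - a).re := by simpa using hac
  have h := Complex.betaIntegral_eq_Gamma_mul_div (a + Complex.I * y) (c - a)
    (by simpa using ha) hδ
  rw [show a + Complex.I * y + (c - a) = c + Complex.I * y by ring,
    betaIntegral_eq_setIntegral] at h
  have hcongr : ∫ t : ℝ in Ioc 0 1, (t : ℂ) ^ (a - 1) * (1 - (t : ℂ)) ^ (c - a - 1) *
      Complex.exp (Complex.I * y * (Real.log t : ℝ)) =
      ∫ t : ℝ in Ioc 0 1, (t : ℂ) ^ (a + Complex.I * y - 1) * (1 - (t : ℂ)) ^ (c - a - 1) := by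
    refine setIntegral_congr_fun measurableSet_Ioc fun t ht => ?_
    have ht0 : (t : ℂ) ≠ 0 := by exact_mod_cast ht.1.ne'
    rw [show a + Complex.I * y - 1 = (a - 1) + Complex.I * y by ring,
      Complex.cpow_add _ _ ht0, Complex.cpow_def_of_ne_zero ht0 (Complex.I * y),
      Complex.ofReal_log ht.1.le, mul_comm (Complex.log t)]
    ring
  rw [hcongr, h]
  have := Complex.Gamma_ne_zero_of_re_pos hδ
  field_simp

/-- The Barnes integral equals `(Γ(α)Γ(β)/Γ(γ)) · ₂F₁(α,β;γ;e^μ)`, the integral converging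
absolutely and the Gauss hypergeometric series converging absolutely. -/
theorem barnes_integral_eq_hypergeometric_series
    (α β γ μ : ℂ) (ε : ℝ)
    (hγα : α.re < γ.re) (hα : 0 < α.re) (hβ : 0 < β.re)
    (hε0 : 0 < ε) (hε : ε < min α.re β.re)
    (hμre : μ.re < 0) (hμim0 : 0 < μ.im) (hμim : μ.im < 2 * π) :
    Integrable (fun y : ℝ =>
      Complex.exp ((-(ε : ℂ) + Complex.I * (y : ℂ)) * (μ - (π : ℂ) * Complex.I)) *
        Complex.Gamma ((ε : ℂ) - Complex.I * (y : ℂ)) *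
        Complex.Gamma (α - (ε : ℂ) + Complex.I * (y : ℂ)) *
        Complex.Gamma (β - (ε : ℂ) + Complex.I * (y : ℂ)) /
        Complex.Gamma (γ - (ε : ℂ) + Complex.I * (y : ℂ))) ∧
    Summable (fun n : ℕ =>
      ‖(ascPochhammer ℂ n).eval α * (ascPochhammer ℂ n).eval β /
          ((ascPochhammer ℂ n).eval γ * (Nat.factorial n : ℂ)) * Complex.exp ((n : ℂ) * μ)‖) ∧
    BarnesB α β γ μ ε =
      Complex.Gamma α * Complex.Gamma β / Complex.Gamma γ *
        ∑' n : ℕ, (ascPochhammer ℂ n).eval α * (ascPochhammer ℂ n).eval β /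
          ((ascPochhammer ℂ n).eval γ * (Nat.factorial n : ℂ)) * Complex.exp ((n : ℂ) * μ) := by
  have hεα : ε < α.re := hε.trans_le (min_le_left _ _)
  have hεβ : ε < β.re := hε.trans_le (min_le_right _ _)
  set v : ℂ := μ - (π : ℂ) * Complex.I with hv
  have hvim : |v.im| < π := by
    have : v.im = μ.im - π := by simp [hv]
    rw [this, abs_lt]; constructor <;> linarith
  have hvre : v.re = μ.re := by simp [hv]
  have hexpv : Complex.exp v = -Complex.exp μ := by
    rw [hv, Complex.exp_sub, Complex.exp_pi_mul_I, div_neg, div_one]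
  have hz : ‖Complex.exp μ‖ < 1 := by rwa [Complex.norm_exp, Real.exp_lt_one_iff]
  have hδ : 0 < (γ - α).re := by simpa using hγα
  have hαε : 0 < (α - ε).re := by simpa using hεα
  set A : ℝ → ℂ := fun y => Complex.Gamma ((ε : ℂ) - Complex.I * y) *
    Complex.Gamma (β - ε + Complex.I * y) *
    Complex.exp ((-(ε : ℂ) + Complex.I * y) * v) with hA
  have hAint : Integrable A := integrable_Gamma_mul_Gamma_mul_cexp (by simpa using hε0)
    (by simpa using hεβ) ε hvim
  set B : ℝ → ℂ := fun t => (t : ℂ) ^ (α - ε - 1) * (1 - (t : ℂ)) ^ (γ - α - 1) with hB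
  have hBint : IntegrableOn B (Ioc 0 1) := integrableOn_beta hαε hδ
  have hratio : ∀ y : ℝ, Complex.Gamma (α - ε + Complex.I * y) /
      Complex.Gamma (γ - ε + Complex.I * y) = (Complex.Gamma (γ - α))⁻¹ *
      ∫ t : ℝ in Ioc 0 1, B t * Complex.exp (Complex.I * y * (Real.log t : ℝ)) := by
    intro y
    have h := Gamma_div_Gamma_eq_integral (c := γ - ε) hαε (by simpa using hγα) y
    rwa [show γ - ε - (α - ε) = γ - α by ring] at h
  have hintegrand : (fun y : ℝ => Complex.exp ((-(ε : ℂ) + Complex.I * (y : ℂ)) * v) *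
        Complex.Gamma ((ε : ℂ) - Complex.I * (y : ℂ)) *
        Complex.Gamma (α - (ε : ℂ) + Complex.I * (y : ℂ)) *
        Complex.Gamma (β - (ε : ℂ) + Complex.I * (y : ℂ)) /
        Complex.Gamma (γ - (ε : ℂ) + Complex.I * (y : ℂ))) =
      fun y : ℝ => (Complex.Gamma (α - ε + Complex.I * y) /
        Complex.Gamma (γ - ε + Complex.I * y)) * A y := by
    ext y
    rw [hA]
    ring
  have hseries : ∀ n : ℕ, Complex.exp (n * μ) = Complex.exp μ ^ n := fun n =>
    Complex.exp_nat_mul μ n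
  have hsum := hasSum_hypergeometric β hα hγα hz
  simp only [BarnesB, ← hv, hseries, hintegrand]
  refine ⟨?_, hsum.summable.norm, ?_⟩
  · have hγε : 0 < (γ - ε).re := by simp; linarith
    refine hAint.bdd_mul (c := ‖(Complex.Gamma (γ - α))⁻¹‖ * ∫ t : ℝ in Ioc 0 1, ‖B t‖) ?_ ?_
    · refine Continuous.aestronglyMeasurable ?_
      exact (continuous_Gamma_add_mul_I hαε).div (continuous_Gamma_add_mul_I hγε)
        fun y => Complex.Gamma_ne_zero_of_re_pos (by simpa using hγε)
    · refine Eventually.of_forall fun y => ?_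
      rw [hratio, norm_mul]
      gcongr
      refine (norm_integral_le_integral_norm _).trans_eq ?_
      congr 1 with t
      rw [norm_mul, Complex.norm_exp]
      simp
  · have hinner : ∀ t ∈ Ioc (0 : ℝ) 1,
        B t * (∫ y : ℝ, A y * Complex.exp (Complex.I * y * (Real.log t : ℝ))) =
        2 * π * Complex.Gamma β * ((t : ℂ) ^ (α - 1) * (1 - (t : ℂ)) ^ (γ - α - 1) *
          (1 - Complex.exp μ * t) ^ (-β)) := by
      intro t ht
      have ht0 : (t : ℂ) ≠ 0 := by exact_mod_cast ht.1.ne'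
      have h := integral_Gamma_mul_Gamma_mul_cexp (v := v + (Real.log t : ℝ)) hε0 hεβ
        (by simpa using hvim)
        (by simpa [hvre] using add_neg_of_neg_of_nonpos hμre (Real.log_nonpos ht.1.le ht.2))
      have hexp : 1 + Complex.exp (v + (Real.log t : ℝ)) = 1 - Complex.exp μ * t := by
        rw [Complex.exp_add, hexpv, Complex.ofReal_log ht.1.le, Complex.exp_log ht0]; ring
      have hcongr : (fun y : ℝ => A y * Complex.exp (Complex.I * y * (Real.log t : ℝ))) =
          fun y : ℝ => (t : ℂ) ^ (ε : ℂ) * (Complex.Gamma ((ε : ℂ) - Complex.I * y) *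
            Complex.Gamma (β - ε + Complex.I * y) *
            Complex.exp ((-(ε : ℂ) + Complex.I * y) * (v + (Real.log t : ℝ)))) := by
        ext y
        rw [hA, Complex.cpow_def_of_ne_zero ht0, ← Complex.ofReal_log ht.1.le, mul_assoc,
          ← Complex.exp_add, mul_left_comm, ← Complex.exp_add]
        congr 2; ring
      rw [hcongr, integral_const_mul, h, hexp, hB,
        show α - 1 = (α - ε - 1) + ε by ring, Complex.cpow_add _ _ ht0]
      ring
    have hswap := integral_mul_integral_cexp_log_swap hAint hBint
    rw [setIntegral_congr_fun measurableSet_Ioc hinner, integral_const_mul] at hswap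
    have hlhs : (fun y : ℝ => (Complex.Gamma (α - ε + Complex.I * y) /
        Complex.Gamma (γ - ε + Complex.I * y)) * A y) = fun y : ℝ =>
        (Complex.Gamma (γ - α))⁻¹ *
        (A y * ∫ t : ℝ in Ioc 0 1, B t * Complex.exp (Complex.I * y * (Real.log t : ℝ))) := by
      ext y
      rw [hratio]
      ring
    rw [hlhs, integral_const_mul, hswap, hsum.tsum_eq]
    have hα0 := Complex.Gamma_ne_zero_of_re_pos hα
    have hδ0 := Complex.Gamma_ne_zero_of_re_pos hδ
    have hγ0 := Complex.Gamma_ne_zero_of_re_pos (hα.trans hγα)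
    have hpi : (π : ℂ) ≠ 0 := by exact_mod_cast Real.pi_ne_zero
    generalize (∫ t : ℝ in Ioc 0 1, (t : ℂ) ^ (α - 1) * (1 - (t : ℂ)) ^ (γ - α - 1) *
      (1 - Complex.exp μ * t) ^ (-β)) = J
    field_simp
end

section
/- Let α, β, γ, μ be complex numbers with Re γ > Re α > 0 and 0 < Im μ < 2π. Then both integrals below converge absolutely and (1−e^{μ})^{γ−α−β} · ∫_{1}^{∞} t^{−β} (t−1)^{α−1} (t−e^{μ})^{β−γ} dt = ∫_{0}^{1} u^{α−1} (1−u)^{γ−α−1} (1−u·e^{μ})^{−β} du. (This is the identity obtained by the change of integration variable u = (t−1)/(t−e^{μ}); for t ≥ 1 and u ∈ [0,1] the quantities t−e^{μ}, 1−e^{μ} and 1−u·e^{μ} never lie in (−∞,0], so all principal powers are well defined.) -/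
open Complex MeasureTheory Real

open Set Filter Topology

/-- A parameter integral `∫ W x * g c x` with `W` integrable and `g` holomorphic in `c`, jointly
continuous over a compact set, is holomorphic. -/
lemma differentiableOn_integral_mul_of_isCompact {U : Set ℂ} (hU : IsOpen U) {A K : Set ℝ}
    (hA : MeasurableSet A) (hK : IsCompact K) (hAK : A ⊆ K) {W : ℝ → ℂ} (hW : IntegrableOn W A)
    {g g' : ℂ → ℝ → ℂ} (hg : ContinuousOn (fun p : ℂ × ℝ => g p.1 p.2) (U ×ˢ K))
    (hg' : ContinuousOn (fun p : ℂ × ℝ => g' p.1 p.2) (U ×ˢ K))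
    (hderiv : ∀ c ∈ U, ∀ x ∈ K, HasDerivAt (fun c => g c x) (g' c x) c) :
    DifferentiableOn ℂ (fun c => ∫ x in A, W x * g c x) U := by
  have slice {h : ℂ → ℝ → ℂ} (hh : ContinuousOn (fun p : ℂ × ℝ => h p.1 p.2) (U ×ˢ K))
      {c : ℂ} (hc : c ∈ U) : ContinuousOn (h c) K :=
    hh.comp (f := fun x : ℝ => (c, x)) (by fun_prop) fun x hx => ⟨hc, hx⟩
  have integrable {h : ℂ → ℝ → ℂ} (hh : ContinuousOn (fun p : ℂ × ℝ => h p.1 p.2) (U ×ˢ K))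
      {c : ℂ} (hc : c ∈ U) : IntegrableOn (fun x => W x * h c x) A :=
    hW.mul_continuousOn_of_subset (slice hh hc) hA hK hAK
  intro c hc
  obtain ⟨ε, hε, hball⟩ := Metric.nhds_basis_closedBall.mem_iff.1 (hU.mem_nhds hc)
  obtain ⟨C, hC⟩ := ((isCompact_closedBall c ε).prod hK).exists_bound_of_continuousOn
    (hg'.mono (prod_mono hball Subset.rfl))
  refine (hasDerivAt_integral_of_dominated_loc_of_deriv_le
    (μ := volume.restrict A) (F := fun c x => W x * g c x) (bound := fun x => ‖W x‖ * C)
    (F' := fun c x => W x * g' c x)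
    (Metric.closedBall_mem_nhds c hε) ?_ (integrable hg hc)
    (integrable hg' hc).aestronglyMeasurable ?_ (hW.norm.mul_const C) ?_).2
      |>.differentiableAt.differentiableWithinAt
  · filter_upwards [hU.mem_nhds hc] with z hz
    exact (integrable hg hz).aestronglyMeasurable
  · refine ae_restrict_of_forall_mem hA fun x hx z hz => ?_
    rw [norm_mul]
    exact mul_le_mul_of_nonneg_left (hC (z, x) ⟨hz, hAK hx⟩) (norm_nonneg _)
  · exact ae_restrict_of_forall_mem hA fun x hx z hz =>
      (hderiv z (hball hz) x (hAK hx)).const_mul (W x)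

lemma one_sub_add_mul_mem_slitPlane {c : ℂ} (hc : c ∈ slitPlane) {x : ℝ} (hx : x ∈ Icc (0 : ℝ) 1) :
    1 - (x : ℂ) + x * c ∈ slitPlane := by
  have := starConvex_one_slitPlane hc (sub_nonneg.2 hx.2) hx.1 (by ring)
  simpa using this

lemma continuousOn_affine_cpow (s : ℂ) {l : ℝ → ℝ} (hl : Continuous l) {K : Set ℝ}
    (hlK : MapsTo l K (Icc 0 1)) :
    ContinuousOn (fun p : ℂ × ℝ => (1 - (l p.2 : ℂ) + l p.2 * p.1) ^ s) (slitPlane ×ˢ K) :=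
  ContinuousOn.cpow_const (by fun_prop) fun _ hp => one_sub_add_mul_mem_slitPlane hp.1 (hlK hp.2)

lemma differentiableOn_integral_mul_affine_cpow (s : ℂ) {W : ℝ → ℂ}
    (hW : IntegrableOn W (Ioo 0 1)) {l : ℝ → ℝ} (hl : Continuous l)
    (hlK : MapsTo l (Icc 0 1) (Icc 0 1)) :
    DifferentiableOn ℂ
      (fun c : ℂ => ∫ x in Ioo (0 : ℝ) 1, W x * (1 - (l x : ℂ) + l x * c) ^ s) slitPlane := by
  refine differentiableOn_integral_mul_of_isCompact isOpen_slitPlane measurableSet_Ioo isCompact_Icc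
    Ioo_subset_Icc_self hW
    (g' := fun c x => s * (1 - (l x : ℂ) + l x * c) ^ (s - 1) * l x)
    (continuousOn_affine_cpow s hl hlK) ?_ fun c hc x hx => ?_
  · exact (continuousOn_const.mul (continuousOn_affine_cpow (s - 1) hl hlK)).mul (by fun_prop)
  · have h : HasDerivAt (fun c : ℂ => 1 - (l x : ℂ) + l x * c) (l x) c := by
      simpa using ((hasDerivAt_id c).const_mul (l x : ℂ)).const_add (1 - (l x : ℂ))
    exact h.cpow_const (one_sub_add_mul_mem_slitPlane hc (hlK hx))

lemma integrableOn_mul_affine_cpow (s : ℂ) {W : ℝ → ℂ} (hW : IntegrableOn W (Ioo 0 1)) {l : ℝ → ℝ}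
    (hl : Continuous l) (hlK : MapsTo l (Icc 0 1) (Icc 0 1)) {c : ℂ} (hc : c ∈ slitPlane) :
    IntegrableOn (fun x : ℝ => W x * (1 - (l x : ℂ) + l x * c) ^ s) (Ioo 0 1) :=
  hW.mul_continuousOn_of_subset
    ((continuousOn_affine_cpow s hl hlK).comp (f := fun x : ℝ => (c, x)) (by fun_prop)
      fun _ hx => ⟨hc, hx⟩) measurableSet_Ioo isCompact_Icc Ioo_subset_Icc_self

/-- The weight of the Euler beta integral is integrable on the open unit interval. -/
lemma integrableOn_beta_weight {a b : ℂ} (ha : 0 < a.re) (hb : 0 < b.re) :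
    IntegrableOn (fun u : ℝ => (u : ℂ) ^ (a - 1) * (1 - (u : ℂ)) ^ (b - 1)) (Ioo 0 1) :=
  ((intervalIntegrable_iff_integrableOn_Ioc_of_le zero_le_one).1
    (betaIntegral_convergent ha hb)).mono_set Ioo_subset_Ioc_self

section Moebius

variable {c : ℝ}

lemma image_moebius_Ioi (hc : 0 < c) :
    (fun t : ℝ => (t - 1) / (t - 1 + c)) '' Ioi 1 = Ioo 0 1 := by
  ext u
  constructor
  · rintro ⟨t, ht, rfl⟩
    have ht' : 0 < t - 1 := sub_pos.2 ht
    exact ⟨by positivity, (div_lt_one (by positivity)).2 (by linarith)⟩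
  · rintro ⟨h0, h1⟩
    have h1' : 0 < 1 - u := sub_pos.2 h1
    refine ⟨1 + c * u / (1 - u), ?_, ?_⟩
    · have : 0 < c * u / (1 - u) := by positivity
      simpa using this
    · have : c * u + c * (1 - u) ≠ 0 := by
        rw [← mul_add]; simpa using hc.ne'
      simp only [add_sub_cancel_left]
      field_simp
      ring

lemma injOn_moebius_Ioi (hc : 0 < c) : InjOn (fun t : ℝ => (t - 1) / (t - 1 + c)) (Ioi 1) := by
  intro s hs t ht h
  have hs' : 0 < s - 1 := sub_pos.2 hs
  have ht' : 0 < t - 1 := sub_pos.2 ht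
  simp only at h
  rw [div_eq_div_iff (by positivity) (by positivity)] at h
  have : c * (s - t) = 0 := by linear_combination h
  have := (mul_eq_zero.1 this).resolve_left hc.ne'
  linarith

lemma hasDerivWithinAt_moebius (hc : 0 < c) (t : ℝ) (ht : t ∈ Ioi 1) :
    HasDerivWithinAt (fun t : ℝ => (t - 1) / (t - 1 + c)) (c / (t - 1 + c) ^ 2) (Ioi 1) t := by
  have ht' : 0 < t - 1 := sub_pos.2 ht
  have hn : HasDerivAt (fun t : ℝ => t - 1) 1 t := (hasDerivAt_id t).sub_const 1
  refine ((hn.div (hn.add_const c) (by positivity)).congr_deriv ?_).hasDerivWithinAt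
  congr 1
  ring

lemma abs_moebius_deriv (hc : 0 < c) (t : ℝ) : |c / (t - 1 + c) ^ 2| = c / (t - 1 + c) ^ 2 :=
  abs_of_nonneg (by positivity)

lemma integrableOn_Ioo_iff_moebius (hc : 0 < c) (g : ℝ → ℂ) :
    IntegrableOn g (Ioo 0 1) ↔ IntegrableOn
      (fun t : ℝ => (c / (t - 1 + c) ^ 2) • g ((t - 1) / (t - 1 + c))) (Ioi 1) := by
  have := integrableOn_image_iff_integrableOn_abs_deriv_smul measurableSet_Ioi
    (hasDerivWithinAt_moebius hc) (injOn_moebius_Ioi hc) g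
  simpa only [image_moebius_Ioi hc, abs_moebius_deriv hc] using this

lemma integral_Ioo_eq_moebius (hc : 0 < c) (g : ℝ → ℂ) :
    ∫ u in Ioo 0 1, g u =
      ∫ t in Ioi 1, (c / (t - 1 + c) ^ 2) • g ((t - 1) / (t - 1 + c)) := by
  have := integral_image_eq_integral_abs_deriv_smul measurableSet_Ioi
    (hasDerivWithinAt_moebius hc) (injOn_moebius_Ioi hc) g
  simpa only [image_moebius_Ioi hc, abs_moebius_deriv hc] using this

end Moebius

lemma div_ofReal_cpow (w : ℂ) {b : ℝ} (hb : 0 < b) (s : ℂ) :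
    (w / b) ^ s = w ^ s * (b : ℂ) ^ (-s) := by
  have hb' : (b : ℂ) ≠ 0 := ofReal_ne_zero.2 hb.ne'
  rcases eq_or_ne w 0 with rfl | hw
  · rcases eq_or_ne s 0 with rfl | hs
    · simp
    · simp [hs]
  · rw [cpow_def_of_ne_zero (div_ne_zero hw hb'), cpow_def_of_ne_zero hw, cpow_def_of_ne_zero hb',
      ← Complex.exp_add, div_eq_mul_inv, ← ofReal_inv, log_mul_ofReal _ (inv_pos.2 hb) _ hw,
      Real.log_inv, ← ofReal_log hb.le]
    congr 1
    push_cast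
    ring

lemma moebius_one_pullback (α β γ c : ℂ) {t : ℝ} (ht : 1 < t) :
    ((1 : ℝ) / (t - 1 + 1) ^ 2) •
      ((((t - 1) / (t - 1 + 1) : ℝ) : ℂ) ^ (α - 1) *
        (1 - (((t - 1) / (t - 1 + 1) : ℝ) : ℂ)) ^ (γ - α - 1) *
        (1 - ((1 - (t - 1) / (t - 1 + 1) : ℝ) : ℂ) +
          ((1 - (t - 1) / (t - 1 + 1) : ℝ) : ℂ) * c) ^ (β - γ)) =
      (t : ℂ) ^ (-β) * ((t : ℂ) - 1) ^ (α - 1) * ((t : ℂ) - (1 - c)) ^ (β - γ) := by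
  have ht0 : 0 < t := by linarith
  have ht' : (t : ℂ) ≠ 0 := ofReal_ne_zero.2 ht0.ne'
  have h1 : (((t - 1) / (t - 1 + 1) : ℝ) : ℂ) = ((t : ℂ) - 1) / (t : ℝ) := by
    push_cast; ring
  have h2 : 1 - (((t - 1) / (t - 1 + 1) : ℝ) : ℂ) = 1 / (t : ℝ) := by
    rw [h1]; field_simp; ring
  have h3 : 1 - ((1 - (t - 1) / (t - 1 + 1) : ℝ) : ℂ) +
      ((1 - (t - 1) / (t - 1 + 1) : ℝ) : ℂ) * c = ((t : ℂ) - (1 - c)) / (t : ℝ) := by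
    rw [ofReal_sub, ofReal_one, h2]; field_simp; ring
  have h4 : (((1 : ℝ) / (t - 1 + 1) ^ 2 : ℝ) : ℂ) = (t : ℂ) ^ (-2 : ℂ) := by
    rw [cpow_neg, show (2 : ℂ) = (2 : ℕ) by norm_num, cpow_natCast]
    push_cast; ring
  rw [real_smul, h3, h2, h1, h4, div_ofReal_cpow _ ht0, div_ofReal_cpow _ ht0,
    div_ofReal_cpow _ ht0, one_cpow]
  have h5 : (t : ℂ) ^ (-β) = (t : ℂ) ^ (-2 : ℂ) * (t : ℂ) ^ (-(α - 1)) *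
      (t : ℂ) ^ (-(γ - α - 1)) * (t : ℂ) ^ (-(β - γ)) := by
    simp only [← cpow_add _ _ ht']
    congr 1; ring
  rw [h5]
  ring

lemma moebius_real_pullback (α β γ : ℂ) {c : ℝ} (hc : 0 < c) {t : ℝ} (ht : 1 < t) :
    (c / (t - 1 + c) ^ 2) •
      ((((t - 1) / (t - 1 + c) : ℝ) : ℂ) ^ (α - 1) *
        (1 - (((t - 1) / (t - 1 + c) : ℝ) : ℂ)) ^ (γ - α - 1) *
        (1 - (((t - 1) / (t - 1 + c) : ℝ) : ℂ) + (((t - 1) / (t - 1 + c) : ℝ) : ℂ) * c) ^ (-β)) =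
      (c : ℂ) ^ (γ - α - β) *
      ((t : ℂ) ^ (-β) * ((t : ℂ) - 1) ^ (α - 1) * ((t : ℂ) - (1 - c)) ^ (β - γ)) := by
  have ht0 : 0 < t := by linarith
  have hs0 : 0 < t - 1 + c := by linarith
  set s : ℝ := t - 1 + c with hs
  have hs' : (s : ℂ) ≠ 0 := ofReal_ne_zero.2 hs0.ne'
  have hc' : (c : ℂ) ≠ 0 := ofReal_ne_zero.2 hc.ne'
  have hsc : (t : ℂ) - (1 - c) = s := by rw [hs]; push_cast; ring
  have h1 : (((t - 1) / s : ℝ) : ℂ) = ((t : ℂ) - 1) / (s : ℝ) := by push_cast; ring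
  have h2 : 1 - (((t - 1) / s : ℝ) : ℂ) = (c : ℂ) / (s : ℝ) := by
    rw [h1]; field_simp; rw [← hsc]; ring
  have h3 : 1 - (((t - 1) / s : ℝ) : ℂ) + (((t - 1) / s : ℝ) : ℂ) * c =
      ((c : ℂ) * (t : ℂ)) / (s : ℝ) := by
    rw [h2, h1]; field_simp; ring
  have h4 : ((c / s ^ 2 : ℝ) : ℂ) = (c : ℂ) ^ (1 : ℂ) * (s : ℂ) ^ (-2 : ℂ) := by
    rw [cpow_neg, show (2 : ℂ) = (2 : ℕ) by norm_num, cpow_natCast, cpow_one]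
    push_cast; ring
  rw [real_smul, h3, h2, h1, h4, hsc, div_ofReal_cpow _ hs0, div_ofReal_cpow _ hs0,
    div_ofReal_cpow _ hs0, mul_cpow_ofReal_nonneg hc.le ht0.le]
  have h5 : (s : ℂ) ^ (β - γ) = (s : ℂ) ^ (-2 : ℂ) * (s : ℂ) ^ (-(α - 1)) *
      (s : ℂ) ^ (-(γ - α - 1)) * (s : ℂ) ^ (-(-β)) := by
    simp only [← cpow_add _ _ hs']
    congr 1; ring
  have h6 : (c : ℂ) ^ (γ - α - β) =
      (c : ℂ) ^ (1 : ℂ) * (c : ℂ) ^ (γ - α - 1) * (c : ℂ) ^ (-β) := by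
    simp only [← cpow_add _ _ hc']
    congr 1; ring
  rw [h5, h6]
  ring

lemma mapsTo_one_sub_Icc : MapsTo (fun u : ℝ => 1 - u) (Icc 0 1) (Icc 0 1) :=
  fun _ hu => ⟨sub_nonneg.2 hu.2, sub_le_self 1 hu.1⟩

/-- Both Euler-type integrals are holomorphic in `c` on the slit plane and agree for `c > 0`. -/
lemma cpow_mul_euler_integral_eq {α β γ : ℂ} (hα : 0 < α.re) (hγα : α.re < γ.re) {c : ℂ}
    (hc : c ∈ slitPlane) :
    c ^ (γ - α - β) * ∫ u in Ioo (0 : ℝ) 1, (u : ℂ) ^ (α - 1) * (1 - (u : ℂ)) ^ (γ - α - 1) *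
        (1 - ((1 - u : ℝ) : ℂ) + ((1 - u : ℝ) : ℂ) * c) ^ (β - γ) =
      ∫ u in Ioo (0 : ℝ) 1, (u : ℂ) ^ (α - 1) * (1 - (u : ℂ)) ^ (γ - α - 1) *
        (1 - (u : ℂ) + u * c) ^ (-β) := by
  have hW := integrableOn_beta_weight hα (b := γ - α) (by simpa using hγα)
  have hL : DifferentiableOn ℂ (fun c : ℂ => c ^ (γ - α - β) *
      ∫ u in Ioo (0 : ℝ) 1, (u : ℂ) ^ (α - 1) * (1 - (u : ℂ)) ^ (γ - α - 1) *
        (1 - ((1 - u : ℝ) : ℂ) + ((1 - u : ℝ) : ℂ) * c) ^ (β - γ)) slitPlane :=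
    (differentiableOn_id.cpow_const fun _ h => h).mul
      (differentiableOn_integral_mul_affine_cpow _ hW (by fun_prop) mapsTo_one_sub_Icc)
  have hR : DifferentiableOn ℂ (fun c : ℂ =>
      ∫ u in Ioo (0 : ℝ) 1, (u : ℂ) ^ (α - 1) * (1 - (u : ℂ)) ^ (γ - α - 1) *
        (1 - (u : ℂ) + u * c) ^ (-β)) slitPlane :=
    differentiableOn_integral_mul_affine_cpow _ hW continuous_id (mapsTo_id _)
  refine (hL.analyticOnNhd isOpen_slitPlane).eqOn_of_preconnected_of_frequently_eq
    (hR.analyticOnNhd isOpen_slitPlane)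
    (starConvex_one_slitPlane.isPathConnected one_mem_slitPlane).isConnected.isPreconnected
    one_mem_slitPlane ?_ hc
  have hreal : ∃ᶠ x : ℝ in 𝓝[≠] 1, 0 < x :=
    ((eventually_gt_nhds (zero_lt_one' ℝ)).filter_mono nhdsWithin_le_nhds).frequently
  have htend : Tendsto (fun x : ℝ => (x : ℂ)) (𝓝[≠] 1) (𝓝[≠] 1) := by
    refine tendsto_nhdsWithin_iff.2 ⟨?_, ?_⟩
    · simpa using (continuous_ofReal.tendsto 1).mono_left (nhdsWithin_le_nhds (s := {1}ᶜ))
    · filter_upwards [self_mem_nhdsWithin] with x hx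
      simpa using hx
  refine htend.frequently (hreal.mono fun x hx => ?_)
  rw [integral_Ioo_eq_moebius one_pos, integral_Ioo_eq_moebius hx, ← integral_const_mul]
  refine setIntegral_congr_fun measurableSet_Ioi fun t ht => ?_
  rw [moebius_one_pullback α β γ x ht, moebius_real_pullback α β γ hx ht]

lemma one_sub_exp_mem_slitPlane {μ : ℂ} (h0 : 0 < μ.im) (h1 : μ.im < 2 * π) :
    1 - Complex.exp μ ∈ slitPlane := by
  rw [mem_slitPlane_iff]
  by_cases hs : Real.sin μ.im = 0
  · left
    have hpi : μ.im = π := by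
      have : Real.sin (μ.im - π) = 0 := by rw [Real.sin_sub_pi, hs, neg_zero]
      have := (Real.sin_eq_zero_iff_of_lt_of_lt (by linarith) (by linarith)).1 this
      linarith
    rw [sub_re, one_re, exp_re, hpi, Real.cos_pi]
    linarith [Real.exp_pos μ.re]
  · right
    simpa [exp_im, (Real.exp_pos _).ne'] using hs

/-- Change of variable `u = (t−1)/(t−e^μ)` identity:
`(1−e^μ)^{γ−α−β} ∫_{1}^{∞} t^{−β} (t−1)^{α−1} (t−e^μ)^{β−γ} dt
  = ∫_{0}^{1} u^{α−1} (1−u)^{γ−α−1} (1−u e^μ)^{−β} du`,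
both integrals converging absolutely. -/
theorem loop_integral_eq_euler_integral
    (α β γ μ : ℂ) (hγα : α.re < γ.re) (hα : 0 < α.re)
    (hμim0 : 0 < μ.im) (hμim : μ.im < 2 * π) :
    IntegrableOn (fun t : ℝ =>
      (t : ℂ) ^ (-β) * ((t : ℂ) - 1) ^ (α - 1) *
        ((t : ℂ) - Complex.exp μ) ^ (β - γ)) (Set.Ioi 1) ∧
    IntegrableOn (fun u : ℝ =>
      (u : ℂ) ^ (α - 1) * (1 - (u : ℂ)) ^ (γ - α - 1) *
        (1 - (u : ℂ) * Complex.exp μ) ^ (-β)) (Set.Ioo 0 1) ∧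
    (1 - Complex.exp μ) ^ (γ - α - β) *
        ∫ t : ℝ in Set.Ioi 1,
          (t : ℂ) ^ (-β) * ((t : ℂ) - 1) ^ (α - 1) *
            ((t : ℂ) - Complex.exp μ) ^ (β - γ) =
      ∫ u : ℝ in Set.Ioo 0 1,
        (u : ℂ) ^ (α - 1) * (1 - (u : ℂ)) ^ (γ - α - 1) *
          (1 - (u : ℂ) * Complex.exp μ) ^ (-β) := by
  have hc := one_sub_exp_mem_slitPlane hμim0 hμim
  have hW := integrableOn_beta_weight hα (b := γ - α) (by simpa using hγα)
  have hpull : ∀ t ∈ Ioi (1 : ℝ), _ = _ := fun t ht =>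
    moebius_one_pullback α β γ (1 - Complex.exp μ) ht
  have haff (u : ℝ) : 1 - (u : ℂ) * Complex.exp μ = 1 - (u : ℂ) + u * (1 - Complex.exp μ) := by
    ring
  simp only [sub_sub_cancel (1 : ℂ) (Complex.exp μ)] at hpull
  simp only [haff]
  refine ⟨?_, integrableOn_mul_affine_cpow _ hW continuous_id (mapsTo_id _) hc, ?_⟩
  · exact ((integrableOn_Ioo_iff_moebius one_pos _).1
      (integrableOn_mul_affine_cpow (β - γ) hW (by fun_prop) mapsTo_one_sub_Icc hc)).congr_fun
        hpull measurableSet_Ioi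
  · rw [← cpow_mul_euler_integral_eq hα hγα hc, integral_Ioo_eq_moebius one_pos,
      setIntegral_congr_fun measurableSet_Ioi hpull]
end
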